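/- Refined Sobolev inequality: For d ≥ 3 there is a constant C > 0 such that for all u ∈ Ḣ^1(ℝ^d), ‖u‖_{L^p(ℝ^d)} ≤ C ‖∇u‖_{L^2}^{2/p} ‖∇u‖_B^{1−2/p}, where 1/p = 1/2 − 1/d (i.e. p = 2d/(d−2)) and ‖f‖_B := sup_{k∈ℤ} (∫_{2^k ≤ |ξ| ≤ 2^{k+1}} |\hat f(ξ)|^2 dξ)^{1/2}. -/

import Mathlib

open MeasureTheory FourierTransform
open scoped ContDiff

lemma annulus_bound {d : ℕ} (f : EuclideanSpace ℝ (Fin d) → ℂ)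
    (hf : Continuous f) {a B t : ℝ} (ha : 0 < a) (hB : 0 < B) (ht : 0 < t)
    (hta : t ^ 2 * a ^ 2 = a ^ d)
    (h : ∫ ξ in {ξ : EuclideanSpace ℝ (Fin d) | a ≤ ‖ξ‖ ∧ ‖ξ‖ ≤ 2 * a}, ‖ξ‖ ^ 2 * ‖f ξ‖ ^ 2 ≤ B ^ 2) :
    ∫⁻ ξ in {ξ : EuclideanSpace ℝ (Fin d) | a ≤ ‖ξ‖ ∧ ‖ξ‖ ≤ 2 * a}, ‖f ξ‖ₑ ≤
      ENNReal.ofReal ((volume.real (Metric.ball (0 : EuclideanSpace ℝ (Fin d)) 1) * 2 ^ d / 2 + 1 / 2)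
        * B * t) := by
  set S := {ξ : EuclideanSpace ℝ (Fin d) | a ≤ ‖ξ‖ ∧ ‖ξ‖ ≤ 2 * a} with hS
  set V := volume.real (Metric.ball (0 : EuclideanSpace ℝ (Fin d)) 1) with hV
  have hSsub : S ⊆ Metric.closedBall 0 (2 * a) := fun x hx => by simpa using hx.2
  have hScl : IsClosed S :=
    (isClosed_le continuous_const continuous_norm).inter (isClosed_le continuous_norm continuous_const)
  have hSc : IsCompact S := (isCompact_closedBall _ _).of_isClosed_subset hScl hSsub
  have i1 : IntegrableOn (fun ξ => ‖f ξ‖) S := hf.norm.continuousOn.integrableOn_compact hSc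
  have i2 : IntegrableOn (fun ξ => ‖ξ‖ ^ 2 * ‖f ξ‖ ^ 2) S :=
    ContinuousOn.integrableOn_compact hSc (by fun_prop)
  have i0 : IntegrableOn (fun ξ => (1 : ℝ)) S :=
    ContinuousOn.integrableOn_compact hSc (by fun_prop)
  have hvol : volume.real S ≤ (2 * a) ^ d * V := by
    calc volume.real S ≤ volume.real (Metric.closedBall (0 : EuclideanSpace ℝ (Fin d)) (2 * a)) :=
          measureReal_mono hSsub (isCompact_closedBall _ _).measure_ne_top
      _ = _ := by
        rw [Measure.addHaar_real_closedBall _ _ (by positivity)]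
        simp [hV]
  set ε := B * t / a ^ d with hε
  have hε0 : 0 < ε := by positivity
  have key : ∫ ξ in S, ‖f ξ‖ ≤ (V * 2 ^ d / 2 + 1 / 2) * B * t := by
    calc ∫ ξ in S, ‖f ξ‖ ≤ ∫ ξ in S, ((ε / 2) * 1 + (1 / (2 * ε * a ^ 2)) * (‖ξ‖ ^ 2 * ‖f ξ‖ ^ 2)) := by
          apply setIntegral_mono_on i1 _ hScl.measurableSet
          · intro ξ hξ
            have h1 : a ^ 2 ≤ ‖ξ‖ ^ 2 := pow_le_pow_left₀ ha.le hξ.1 2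
            have h2 : (1 / (2 * ε * a ^ 2)) * (a ^ 2 * ‖f ξ‖ ^ 2) ≤
                (1 / (2 * ε * a ^ 2)) * (‖ξ‖ ^ 2 * ‖f ξ‖ ^ 2) := by gcongr
            have h3 : (1 / (2 * ε * a ^ 2)) * (a ^ 2 * ‖f ξ‖ ^ 2) = ‖f ξ‖ ^ 2 / (2 * ε) := by
              field_simp
            have h4 : ‖f ξ‖ ≤ ε / 2 * 1 + ‖f ξ‖ ^ 2 / (2 * ε) := by
              rw [← sub_nonneg]
              have : ε / 2 * 1 + ‖f ξ‖ ^ 2 / (2 * ε) - ‖f ξ‖ = (ε - ‖f ξ‖) ^ 2 / (2 * ε) := by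
                field_simp; ring
              rw [this]; positivity
            linarith
          · exact (i0.const_mul _).add (i2.const_mul _)
      _ = (ε / 2) * volume.real S + (1 / (2 * ε * a ^ 2)) * ∫ ξ in S, (‖ξ‖ ^ 2 * ‖f ξ‖ ^ 2) := by
          rw [integral_add (i0.const_mul _) (i2.const_mul _), integral_const_mul, integral_const_mul]
          simp
      _ ≤ (ε / 2) * ((2 * a) ^ d * V) + (1 / (2 * ε * a ^ 2)) * B ^ 2 := by gcongr
      _ = _ := by
          have e1 : ε / 2 * ((2 * a) ^ d * V) = V * 2 ^ d / 2 * B * t := by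
            rw [hε, mul_pow]; field_simp
          have e2 : (1 / (2 * ε * a ^ 2)) * B ^ 2 = 1 / 2 * B * t := by
            rw [hε, ← hta]; field_simp
          rw [e1, e2]; ring
  calc ∫⁻ ξ in S, ‖f ξ‖ₑ = ENNReal.ofReal (∫ ξ in S, ‖f ξ‖) := by
        rw [ofReal_integral_eq_lintegral_ofReal i1 (Filter.Eventually.of_forall fun _ => norm_nonneg _)]
        simp
    _ ≤ _ := ENNReal.ofReal_le_ofReal key

lemma low_bound {d : ℕ} (hd : 3 ≤ d) : ∃ M > (0 : ℝ), ∀ (f : EuclideanSpace ℝ (Fin d) → ℂ)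
    (_ : Continuous f) (B : ℝ) (_ : 0 < B)
    (_ : ∀ k : ℤ, ∫ ξ in {ξ : EuclideanSpace ℝ (Fin d) | (2 : ℝ) ^ k ≤ ‖ξ‖ ∧ ‖ξ‖ ≤ (2 : ℝ) ^ (k + 1)},
      ‖ξ‖ ^ 2 * ‖f ξ‖ ^ 2 ≤ B ^ 2) (K : ℤ),
    ∫⁻ ξ in Metric.ball (0 : EuclideanSpace ℝ (Fin d)) ((2 : ℝ) ^ K), ‖f ξ‖ₑ ≤
      ENNReal.ofReal (M * B * ((2 : ℝ) ^ K) ^ (((d : ℝ) - 2) / 2)) := by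
  set s : ℝ := ((d : ℝ) - 2) / 2 with hs
  have hd' : (3 : ℝ) ≤ d := by exact_mod_cast hd
  have hs0 : 0 < s := by rw [hs]; linarith
  set c := volume.real (Metric.ball (0 : EuclideanSpace ℝ (Fin d)) 1) * 2 ^ d / 2 + 1 / 2 with hc
  have hc0 : 0 < c := by positivity
  set r : ℝ := ((2 : ℝ)⁻¹) ^ s with hr
  have hr0 : 0 < r := by positivity
  have hr1 : r < 1 := Real.rpow_lt_one (by norm_num) (by norm_num) hs0
  have h1r : 0 < 1 - r := by linarith
  refine ⟨c * (1 - r)⁻¹, by positivity, ?_⟩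
  intro f hf B hB hk K
  have : Nontrivial (EuclideanSpace ℝ (Fin d)) := by
    apply Module.nontrivial_of_finrank_pos (R := ℝ)
    simp; omega
  set A : ℕ → Set (EuclideanSpace ℝ (Fin d)) :=
    fun n => {ξ | (2 : ℝ) ^ (K - 1 - n) ≤ ‖ξ‖ ∧ ‖ξ‖ ≤ 2 * (2 : ℝ) ^ (K - 1 - n)} with hA
  have hsub : Metric.ball (0 : EuclideanSpace ℝ (Fin d)) ((2 : ℝ) ^ K) ≤ᵐ[volume] ⋃ n, A n := by
    have h0 : ∀ᵐ ξ : EuclideanSpace ℝ (Fin d), ξ ≠ 0 := by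
      simp [ae_iff]
    filter_upwards [h0] with ξ hξ hb
    have hb' : ‖ξ‖ < 2 ^ K := mem_ball_zero_iff.1 hb
    obtain ⟨n, hn1, hn2⟩ := exists_mem_Ico_zpow (norm_pos_iff.2 hξ) (one_lt_two (α := ℝ))
    have hnK : n < K := (zpow_lt_zpow_iff_right₀ (one_lt_two (α := ℝ))).1 (hn1.trans_lt hb')
    have : K - 1 - ((K - 1 - n).toNat : ℤ) = n := by omega
    refine Set.mem_iUnion.2 ⟨(K - 1 - n).toNat, ?_⟩
    simp only [hA, Set.mem_ofPred_eq, this]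
    refine ⟨hn1, ?_⟩
    rw [zpow_add_one₀ (by norm_num)] at hn2
    linarith
  have hpow : ∀ n : ℕ, ((2 : ℝ) ^ (K - 1 - n)) ^ s ≤ ((2 : ℝ) ^ K) ^ s * r ^ n := by
    intro n
    have : r ^ n = (((2 : ℝ)⁻¹) ^ n) ^ s := by
      rw [hr, ← Real.rpow_natCast, ← Real.rpow_natCast, ← Real.rpow_mul (by norm_num),
        ← Real.rpow_mul (by norm_num), mul_comm]
    rw [this, ← Real.mul_rpow (by positivity) (by positivity)]
    apply Real.rpow_le_rpow (by positivity) _ hs0.le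
    rw [inv_pow, ← zpow_natCast, ← zpow_neg, ← zpow_add₀ (by norm_num)]
    apply zpow_le_zpow_right₀ (by norm_num)
    omega
  calc _ ≤ ∫⁻ ξ in ⋃ n, A n, ‖f ξ‖ₑ := lintegral_mono_set' hsub
    _ ≤ ∑' n, ∫⁻ ξ in A n, ‖f ξ‖ₑ := lintegral_iUnion_le _ _
    _ ≤ ∑' n : ℕ, ENNReal.ofReal (c * B * ((2 : ℝ) ^ K) ^ s * r ^ n) := by
        apply ENNReal.tsum_le_tsum
        intro n
        have hn := hk (K - 1 - n)
        rw [zpow_add_one₀ (by norm_num), mul_comm _ (2 : ℝ)] at hn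
        refine (annulus_bound f hf (t := ((2 : ℝ) ^ (K - 1 - n)) ^ s) (by positivity) hB (by positivity) ?_ hn).trans ?_
        · generalize ha : (2 : ℝ) ^ (K - 1 - n) = a
          have ha0 : 0 < a := by rw [← ha]; positivity
          rw [← Real.rpow_natCast, ← Real.rpow_mul ha0.le, ← Real.rpow_natCast, ← Real.rpow_add ha0,
            ← Real.rpow_natCast]
          congr 1
          rw [hs]; push_cast; ring
        · apply ENNReal.ofReal_le_ofReal
          have := mul_le_mul_of_nonneg_left (hpow n) (mul_pos hc0 hB).le
          rw [← hc, mul_assoc (c * B)]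
          exact this
    _ = ENNReal.ofReal (∑' n : ℕ, (c * B * ((2 : ℝ) ^ K) ^ s * r ^ n)) := by
        rw [ENNReal.ofReal_tsum_of_nonneg]
        · intro n; positivity
        · exact (summable_geometric_of_lt_one hr0.le hr1).mul_left _
    _ = _ := by
        rw [tsum_mul_left, tsum_geometric_of_lt_one hr0.le hr1]
        congr 1; ring

lemma decomp {V : Type*} [NormedAddCommGroup V] [InnerProductSpace ℝ V] [FiniteDimensional ℝ V]
    [MeasurableSpace V] [BorelSpace V] (u G h : V → ℂ) (hu : Integrable u)
    (hG : Integrable G) (hh : MemLp h 2) (hs : ∀ ξ, 𝓕 u ξ = G ξ + h ξ) :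
    ∃ w : Lp (α := V) ℂ 2, ‖w‖ = ‖hh.toLp h‖ ∧ ∀ᵐ x, u x = 𝓕⁻ G x + w x := by
  have hnc : Continuous fun p : V × V => (-innerₗ V) p.1 p.2 := (continuous_inner (𝕜 := ℝ) (E := V)).neg
  set H : Lp (α := V) ℂ 2 volume := hh.toLp h with hH
  have hn : ‖(𝓕⁻ H : Lp (α := V) ℂ 2 volume)‖ = ‖H‖ := by
    rw [← Lp.norm_fourier_eq, fourier_fourierInv_eq]
  refine ⟨𝓕⁻ H, hn, ?_⟩
  have hGc : Continuous (𝓕⁻ G : V → ℂ) :=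
    VectorFourier.fourierIntegral_continuous Real.continuous_fourierChar
      (L := -innerₗ V) hnc hG
  have hGl : LocallyIntegrable (𝓕⁻ G : V → ℂ) := hGc.locallyIntegrable
  have hwl : LocallyIntegrable ((𝓕⁻ H : Lp (α := V) ℂ 2 volume) : V → ℂ) :=
    (Lp.memLp _).locallyIntegrable (by norm_num)
  apply ae_eq_of_integral_contDiff_smul_eq hu.locallyIntegrable (hGl.add hwl)
  intro g g_smooth g_cpt
  have hg₁ : HasCompactSupport (Complex.ofRealCLM ∘ g) := g_cpt.comp_left rfl
  have hg₂ : ContDiff ℝ ∞ (Complex.ofRealCLM ∘ g) := by fun_prop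
  set ψ : SchwartzMap V ℂ := hg₁.toSchwartzMap hg₂ with hψ
  have hψa : ∀ x, ψ x = (g x : ℂ) := fun x => by simp [hψ]
  set φ : SchwartzMap V ℂ := 𝓕⁻ ψ with hφ
  have hφψ : 𝓕 φ = ψ := by rw [hφ, fourier_fourierInv_eq]
  have e1 : ∫ x, ψ x • u x = ∫ ξ, φ ξ • 𝓕 u ξ := by
    rw [← hφψ]
    have := VectorFourier.integral_fourierIntegral_smul_eq_flip (L := innerₗ V)
      Real.continuous_fourierChar continuous_inner (φ.integrable (μ := volume)) hu
    simpa [SchwartzMap.fourier_coe] using! this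
  have e2 : ∫ x, ψ x • 𝓕⁻ G x = ∫ ξ, φ ξ • G ξ := by
    have := VectorFourier.integral_fourierIntegral_smul_eq_flip (L := -innerₗ V)
      Real.continuous_fourierChar hnc (ψ.integrable (μ := volume)) hG
    have h2 : (-innerₗ V).flip = -innerₗ V := by
      ext x y; simp [real_inner_comm]
    rw [h2] at this
    rw [hφ, SchwartzMap.fourierInv_coe]
    exact this.symm
  have e3 : ∫ x, ψ x • (𝓕⁻ H : Lp (α := V) ℂ 2 volume) x = ∫ ξ, φ ξ • h ξ := by
    rw [← Lp.toTemperedDistribution_apply, ← Lp.fourierInv_toTemperedDistribution_eq,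
      TemperedDistribution.fourierInv_apply, Lp.toTemperedDistribution_apply]
    apply integral_congr_ae
    filter_upwards [hh.coeFn_toLp] with x hx
    rw [hH, hx]
  have iφG : Integrable (fun ξ => φ ξ • G ξ) := by
    simpa using hG.bdd_mul φ.continuous.aestronglyMeasurable
      (c := (SchwartzMap.seminorm ℝ 0 0) φ) (Filter.Eventually.of_forall fun x => φ.norm_le_seminorm ℝ x)
  have iφh : Integrable (fun ξ => φ ξ • h ξ) := by
    have h1 : MemLp (fun ξ => φ ξ) 2 := φ.memLp 2
    simpa using! h1.integrable_mul hh
  have iψG : Integrable (fun ξ => g ξ • 𝓕⁻ G ξ) := by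
    apply Continuous.integrable_of_hasCompactSupport
    · exact g_smooth.continuous.smul hGc
    · exact g_cpt.smul_right
  have iψw : Integrable (fun ξ => g ξ • (𝓕⁻ H : Lp (α := V) ℂ 2 volume) ξ) := 
    hwl.integrable_smul_left_of_hasCompactSupport g_smooth.continuous g_cpt
  simp only [hψa] at e1 e2 e3
  simp only [Pi.add_apply, smul_add]
  rw [integral_add iψG iψw]
  simp only [smul_eq_mul, ← Complex.real_smul] at e1 e2 e3 iφG iφh
  rw [e1, e2, e3, ← integral_add iφG iφh]
  simp [hs, mul_add]

lemma tail {d : ℕ} (u : EuclideanSpace ℝ (Fin d) → ℂ) (hu : Integrable u)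
    (hw : Integrable (fun ξ : EuclideanSpace ℝ (Fin d) => ‖ξ‖ ^ 2 * ‖𝓕 u ξ‖ ^ 2))
    {s c : ℝ} (hs : 0 < s) (hc : 0 < c)
    (hlow : ∀ K : ℤ, ∫⁻ ξ in Metric.ball (0 : EuclideanSpace ℝ (Fin d)) ((2 : ℝ) ^ K), ‖𝓕 u ξ‖ₑ ≤
      ENNReal.ofReal (c * ((2 : ℝ) ^ K) ^ s)) {l : ℝ} (hl : 0 < l) :
    volume {x | l < ‖u x‖} ≤ ENNReal.ofReal (4 / l ^ 2) *
      ∫⁻ ξ, {ξ : EuclideanSpace ℝ (Fin d) | l < 2 * c * (2 * ‖ξ‖) ^ s}.indicator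
        (fun ξ => ‖𝓕 u ξ‖ₑ ^ 2) ξ := by
  have hcont : Continuous (𝓕 u) :=
    VectorFourier.fourierIntegral_continuous Real.continuous_fourierChar
      (L := innerₗ (EuclideanSpace ℝ (Fin d))) continuous_inner hu
  set A : ℝ := (l / (2 * c)) ^ (1 / s) with hA
  have hA0 : 0 < A := by positivity
  have hAs : A ^ s = l / (2 * c) := by
    rw [hA, ← Real.rpow_mul (by positivity), one_div, inv_mul_cancel₀ hs.ne', Real.rpow_one]
  obtain ⟨K, hK1, hK2⟩ := exists_mem_Ico_zpow hA0 (one_lt_two (α := ℝ))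
  set S := Metric.ball (0 : EuclideanSpace ℝ (Fin d)) ((2 : ℝ) ^ K) with hS
  have hSm : MeasurableSet S := Metric.isOpen_ball.measurableSet
  set G := S.indicator (𝓕 u) with hG
  set h := Sᶜ.indicator (𝓕 u) with hh
  have hGi : Integrable G := by
    rw [hG, integrable_indicator_iff hSm]
    exact (hcont.continuousOn.integrableOn_compact (isCompact_closedBall 0 ((2 : ℝ) ^ K))).mono_set
      Metric.ball_subset_closedBall
  have hhm : AEStronglyMeasurable h volume := hcont.aestronglyMeasurable.indicator hSm.compl
  have hh2 : MemLp h 2 := by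
    rw [memLp_two_iff_integrable_sq_norm hhm]
    refine (hw.const_mul ((((2 : ℝ) ^ K) ^ 2)⁻¹)).mono' (hhm.norm.pow 2) (Filter.Eventually.of_forall fun ξ => ?_)
    by_cases hξ : ξ ∈ S
    · simp only [hh, Set.indicator_of_notMem (show ξ ∉ Sᶜ by simpa using hξ)]
      simp; positivity
    · rw [hh, Set.indicator_of_mem (show ξ ∈ Sᶜ from hξ)]
      have h1 : (2 : ℝ) ^ K ≤ ‖ξ‖ := by simpa [hS] using hξ
      have h2 : ((2 : ℝ) ^ K) ^ 2 ≤ ‖ξ‖ ^ 2 := pow_le_pow_left₀ (by positivity) h1 2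
      rw [Real.norm_of_nonneg (by positivity), ← mul_assoc]
      apply le_mul_of_one_le_left (by positivity)
      rw [inv_mul_eq_div, one_le_div (by positivity)]
      exact h2
  obtain ⟨w, hwn, hwu⟩ := decomp u G h hu hGi hh2 (fun ξ => by
    simp [hG, hh])
  have hGsup : ∀ x, ‖𝓕⁻ G x‖ ≤ l / 2 := by
    intro x
    have h1 : ‖𝓕⁻ G x‖ ≤ ∫ ξ, ‖G ξ‖ := by
      rw [Real.fourierInv_eq]
      refine (norm_integral_le_integral_norm _).trans (le_of_eq ?_)
      simp
    refine h1.trans ?_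
    rw [integral_norm_eq_lintegral_enorm hGi.aestronglyMeasurable]
    apply ENNReal.toReal_le_of_le_ofReal (by positivity)
    have h2 : ∫⁻ ξ, ‖G ξ‖ₑ = ∫⁻ ξ in S, ‖𝓕 u ξ‖ₑ := by
      rw [← lintegral_indicator hSm]
      simp only [hG, enorm_indicator_eq_indicator_enorm]
    rw [h2]
    refine (hlow K).trans (ENNReal.ofReal_le_ofReal ?_)
    calc c * ((2 : ℝ) ^ K) ^ s ≤ c * A ^ s := by gcongr
      _ = l / 2 := by rw [hAs]; field_simp
  have hsq : ∫⁻ x, ‖w x‖ₑ ^ 2 = ∫⁻ ξ, ‖h ξ‖ₑ ^ 2 := by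
    have e1 : ‖w‖ₑ = ‖hh2.toLp h‖ₑ := by rw [← ofReal_norm, ← ofReal_norm, hwn]
    rw [Lp.enorm_def, Lp.enorm_def, eLpNorm_congr_ae hh2.coeFn_toLp] at e1
    have h1 := eLpNorm_nnreal_pow_eq_lintegral (f := w) (μ := volume) (p := 2) (by norm_num)
    have h2 := eLpNorm_nnreal_pow_eq_lintegral (f := h) (μ := volume) (p := 2) (by norm_num)
    have e2 : ((2 : NNReal) : ENNReal) = 2 := rfl
    rw [e2] at h1 h2
    rw [e1, h2] at h1
    simpa using h1.symm
  have hsub : volume {x | l < ‖u x‖} ≤ volume {x | ENNReal.ofReal (l ^ 2 / 4) ≤ ‖w x‖ₑ ^ 2} := by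
    apply measure_mono_ae
    filter_upwards [hwu] with x hx hlx
    have hlx' : l < ‖u x‖ := hlx
    have h1 : l / 2 ≤ ‖w x‖ := by
      have := norm_add_le (𝓕⁻ G x) (w x)
      rw [← hx] at this
      linarith [hGsup x]
    show ENNReal.ofReal (l ^ 2 / 4) ≤ ‖w x‖ₑ ^ 2
    rw [← ofReal_norm, ← ENNReal.ofReal_pow (norm_nonneg _)]
    apply ENNReal.ofReal_le_ofReal
    nlinarith
  have hcheb : ENNReal.ofReal (l ^ 2 / 4) * volume {x | ENNReal.ofReal (l ^ 2 / 4) ≤ ‖w x‖ₑ ^ 2} ≤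
      ∫⁻ x, ‖w x‖ₑ ^ 2 := 
    mul_meas_ge_le_lintegral₀ ((Lp.aestronglyMeasurable w).enorm.pow_const 2) _
  have hinv : ENNReal.ofReal (4 / l ^ 2) * ENNReal.ofReal (l ^ 2 / 4) = 1 := by
    rw [← ENNReal.ofReal_mul (by positivity)]
    rw [show 4 / l ^ 2 * (l ^ 2 / 4) = 1 by field_simp]
    simp
  calc volume {x | l < ‖u x‖} ≤ volume {x | ENNReal.ofReal (l ^ 2 / 4) ≤ ‖w x‖ₑ ^ 2} := hsub
    _ = ENNReal.ofReal (4 / l ^ 2) * (ENNReal.ofReal (l ^ 2 / 4) *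
          volume {x | ENNReal.ofReal (l ^ 2 / 4) ≤ ‖w x‖ₑ ^ 2}) := by
        rw [← mul_assoc, hinv, one_mul]
    _ ≤ ENNReal.ofReal (4 / l ^ 2) * ∫⁻ ξ, ‖h ξ‖ₑ ^ 2 := by
        rw [← hsq]; gcongr
    _ ≤ _ := by
        gcongr with ξ
        by_cases hξ : ξ ∈ S
        · simp [hh, Set.indicator_of_notMem (show ξ ∉ Sᶜ by simpa using hξ)]
        · rw [hh, Set.indicator_of_mem (show ξ ∈ Sᶜ from hξ), Set.indicator_of_mem]
          have h1 : (2 : ℝ) ^ K ≤ ‖ξ‖ := by simpa [hS] using hξ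
          rw [zpow_add_one₀ (by norm_num)] at hK2
          have h2 : A ^ s < (2 * ‖ξ‖) ^ s := Real.rpow_lt_rpow hA0.le (by linarith) hs
          rw [hAs, div_lt_iff₀ (by positivity)] at h2
          show l < 2 * c * (2 * ‖ξ‖) ^ s
          linarith

lemma strong {d : ℕ} (u : EuclideanSpace ℝ (Fin d) → ℂ) (hu : Integrable u)
    (hw : Integrable (fun ξ : EuclideanSpace ℝ (Fin d) => ‖ξ‖ ^ 2 * ‖𝓕 u ξ‖ ^ 2))
    {s c p : ℝ} (hs : 0 < s) (hc : 0 < c) (hp : 2 < p) (hsp : s * (p - 2) = 2)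
    (hlow : ∀ K : ℤ, ∫⁻ ξ in Metric.ball (0 : EuclideanSpace ℝ (Fin d)) ((2 : ℝ) ^ K), ‖𝓕 u ξ‖ₑ ≤
      ENNReal.ofReal (c * ((2 : ℝ) ^ K) ^ s)) :
    ∫ x, ‖u x‖ ^ p ≤ (16 * p / (p - 2) * (2 * c) ^ (p - 2)) * ∫ ξ, ‖ξ‖ ^ 2 * ‖𝓕 u ξ‖ ^ 2 := by
  have hcont : Continuous (𝓕 u) :=
    VectorFourier.fourierIntegral_continuous Real.continuous_fourierChar
      (L := innerₗ (EuclideanSpace ℝ (Fin d))) continuous_inner hu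
  have hp2 : 0 < p - 2 := by linarith
  set b : EuclideanSpace ℝ (Fin d) → ℝ := fun ξ => 2 * c * (2 * ‖ξ‖) ^ s with hb
  have hb0 : ∀ ξ, 0 ≤ b ξ := fun ξ => by positivity
  have hbc : Continuous b := by
    have : Continuous fun ξ : EuclideanSpace ℝ (Fin d) => (2 * ‖ξ‖) ^ s :=
      (by fun_prop : Continuous fun ξ : EuclideanSpace ℝ (Fin d) => 2 * ‖ξ‖).rpow_const
        (fun _ => Or.inr hs.le)
    exact continuous_const.mul this
  have hbp : ∀ ξ, b ξ ^ (p - 2) = (2 * c) ^ (p - 2) * (4 * ‖ξ‖ ^ 2) := fun ξ => by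
    rw [hb]
    dsimp only
    rw [Real.mul_rpow (by positivity) (by positivity), ← Real.rpow_mul (by positivity), hsp]
    norm_num
    left; ring
  have hin : ∀ ξ, ∫⁻ t in Set.Ioi (0 : ℝ), (Set.Iio (b ξ)).indicator (fun t => ENNReal.ofReal (4 * t ^ (p - 3))) t
      = ENNReal.ofReal (16 / (p - 2) * (2 * c) ^ (p - 2) * ‖ξ‖ ^ 2) := by
    intro ξ
    rw [lintegral_indicator measurableSet_Iio, Measure.restrict_restrict measurableSet_Iio,
      Set.inter_comm, Set.Ioi_inter_Iio]
    have hii : IntervalIntegrable (fun t : ℝ => 4 * t ^ (p - 3)) volume 0 (b ξ) :=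
      (intervalIntegral.intervalIntegrable_rpow' (by linarith)).const_mul _
    rw [← ofReal_integral_eq_lintegral_ofReal]
    · rw [← integral_Ioc_eq_integral_Ioo, ← intervalIntegral.integral_of_le (hb0 ξ),
        intervalIntegral.integral_const_mul, integral_rpow (Or.inl (by linarith))]
      rw [show p - 3 + 1 = p - 2 by ring, hbp, Real.zero_rpow hp2.ne']
      congr 1; ring
    · exact ((intervalIntegrable_iff_integrableOn_Ioc_of_le (hb0 ξ)).1 hii).mono_set Set.Ioo_subset_Ioc_self
    · filter_upwards [self_mem_ae_restrict measurableSet_Ioo] with t ht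
      have := ht.1
      simp only [Pi.zero_apply]; positivity
  have main : ∫⁻ x, ENNReal.ofReal (‖u x‖ ^ p) ≤
      ENNReal.ofReal ((16 * p / (p - 2) * (2 * c) ^ (p - 2)) * ∫ ξ, ‖ξ‖ ^ 2 * ‖𝓕 u ξ‖ ^ 2) := by
    rw [lintegral_rpow_eq_lintegral_meas_lt_mul volume (Filter.Eventually.of_forall fun _ => norm_nonneg _)
      hu.aestronglyMeasurable.norm.aemeasurable (by linarith)]
    have hmeas : Measurable (fun q : ℝ × EuclideanSpace ℝ (Fin d) =>
        {q : ℝ × EuclideanSpace ℝ (Fin d) | q.1 < b q.2}.indicator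
          (fun q => ENNReal.ofReal (4 * q.1 ^ (p - 3)) * ‖𝓕 u q.2‖ₑ ^ 2) q) := by
      apply Measurable.indicator
      · have := hcont.measurable
        fun_prop
      · exact measurableSet_lt measurable_fst (hbc.measurable.comp measurable_snd)
    calc ENNReal.ofReal p * ∫⁻ t in Set.Ioi 0, volume {a | t < ‖u a‖} * ENNReal.ofReal (t ^ (p - 1))
        ≤ ENNReal.ofReal p * ∫⁻ t in Set.Ioi (0 : ℝ), ∫⁻ ξ, {q : ℝ × EuclideanSpace ℝ (Fin d) | q.1 < b q.2}.indicator
          (fun q => ENNReal.ofReal (4 * q.1 ^ (p - 3)) * ‖𝓕 u q.2‖ₑ ^ 2) (t, ξ) := by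
          gcongr ENNReal.ofReal p * ?_
          apply setLIntegral_mono' measurableSet_Ioi
          intro t ht
          have ht0 : 0 < t := ht
          refine (mul_le_mul_left (tail u hu hw hs hc hlow ht0) _).trans (le_of_eq ?_)
          rw [mul_right_comm, ← ENNReal.ofReal_mul (by positivity), ← lintegral_const_mul' _ _ ENNReal.ofReal_ne_top]
          have ht3 : 4 / t ^ 2 * t ^ (p - 1) = 4 * t ^ (p - 3) := by
            rw [show p - 1 = (p - 3) + (2 : ℕ) by push_cast; ring, Real.rpow_add_natCast ht0.ne']
            field_simp
          rw [ht3]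
          congr 1
          ext ξ
          by_cases hξ : t < b ξ
          · rw [Set.indicator_of_mem (by exact hξ), Set.indicator_of_mem (by exact hξ)]
          · rw [Set.indicator_of_notMem (by exact hξ), Set.indicator_of_notMem (by exact hξ), mul_zero]
      _ = ENNReal.ofReal p * ∫⁻ ξ, ∫⁻ t in Set.Ioi (0 : ℝ), {q : ℝ × EuclideanSpace ℝ (Fin d) | q.1 < b q.2}.indicator
          (fun q => ENNReal.ofReal (4 * q.1 ^ (p - 3)) * ‖𝓕 u q.2‖ₑ ^ 2) (t, ξ) := by
          rw [lintegral_lintegral_swap]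
          exact hmeas.aemeasurable
      _ = ENNReal.ofReal p * ∫⁻ ξ, ENNReal.ofReal (16 / (p - 2) * (2 * c) ^ (p - 2) * (‖ξ‖ ^ 2 * ‖𝓕 u ξ‖ ^ 2)) := by
          congr 1
          apply lintegral_congr
          intro ξ
          have e : ∀ t : ℝ, {q : ℝ × EuclideanSpace ℝ (Fin d) | q.1 < b q.2}.indicator
              (fun q => ENNReal.ofReal (4 * q.1 ^ (p - 3)) * ‖𝓕 u q.2‖ₑ ^ 2) (t, ξ) =
              (Set.Iio (b ξ)).indicator (fun t => ENNReal.ofReal (4 * t ^ (p - 3))) t * ‖𝓕 u ξ‖ₑ ^ 2 := by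
            intro t
            by_cases hξ : t < b ξ
            · rw [Set.indicator_of_mem (by exact hξ), Set.indicator_of_mem (by exact hξ)]
            · rw [Set.indicator_of_notMem (by exact hξ), Set.indicator_of_notMem (by exact hξ), zero_mul]
          simp_rw [e]
          rw [lintegral_mul_const' _ _ (by simp), hin, ← ofReal_norm, ← ENNReal.ofReal_pow (norm_nonneg _),
            ← ENNReal.ofReal_mul (by positivity), mul_assoc _ (‖ξ‖ ^ 2)]
      _ = _ := by
          rw [← ofReal_integral_eq_lintegral_ofReal (hw.const_mul _)
            (Filter.Eventually.of_forall fun ξ => by simp only [Pi.zero_apply]; positivity),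
            ← ENNReal.ofReal_mul (by linarith), integral_const_mul]
          congr 1; ring
  rw [integral_eq_lintegral_of_nonneg_ae (Filter.Eventually.of_forall fun x => by simp only [Pi.zero_apply]; positivity)
    (hu.aestronglyMeasurable.norm.aemeasurable.pow_const p).aestronglyMeasurable]
  refine ENNReal.toReal_le_of_le_ofReal ?_ main
  have : 0 ≤ ∫ ξ, ‖ξ‖ ^ 2 * ‖𝓕 u ξ‖ ^ 2 := integral_nonneg fun ξ => by positivity
  positivity

/-- Refined Sobolev inequality: for `d ≥ 3` there is `C > 0` such that for every
`u ∈ Ḣ¹(ℝ^d)`, `‖u‖_{L^p} ≤ C ‖∇u‖_{L²}^{2/p} ‖∇u‖_B^{1−2/p}` with `p = 2d/(d−2)`,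
where on the Fourier side `‖∇u‖_{L²}² = ∫ |ξ|²|û(ξ)|² dξ` and
`‖∇u‖_B = sup_{k∈ℤ} (∫_{2^k ≤ |ξ| ≤ 2^{k+1}} |ξ|²|û(ξ)|² dξ)^{1/2}`. -/
theorem stmt6 (d : ℕ) (hd : 3 ≤ d) :
    ∃ C > (0 : ℝ), ∀ p : ℝ, p = 2 * (d : ℝ) / ((d : ℝ) - 2) →
      ∀ u : EuclideanSpace ℝ (Fin d) → ℂ, Integrable u →
        Integrable (fun ξ : EuclideanSpace ℝ (Fin d) => ‖ξ‖ ^ 2 * ‖𝓕 u ξ‖ ^ 2) →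
        (∫ x, ‖u x‖ ^ p) ^ (1 / p) ≤
          C * ((∫ ξ, ‖ξ‖ ^ 2 * ‖𝓕 u ξ‖ ^ 2) ^ ((1 : ℝ) / 2)) ^ (2 / p) *
            (⨆ k : ℤ,
              (∫ ξ in {ξ : EuclideanSpace ℝ (Fin d) |
                  (2 : ℝ) ^ k ≤ ‖ξ‖ ∧ ‖ξ‖ ≤ (2 : ℝ) ^ (k + 1)},
                ‖ξ‖ ^ 2 * ‖𝓕 u ξ‖ ^ 2) ^ ((1 : ℝ) / 2)) ^ (1 - 2 / p) := by
  obtain ⟨M, hM, hlow⟩ := low_bound hd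
  have hd' : (3 : ℝ) ≤ d := by exact_mod_cast hd
  have hd2 : (0 : ℝ) < (d : ℝ) - 2 := by linarith
  set P : ℝ := 2 * (d : ℝ) / ((d : ℝ) - 2) with hP
  have hP2 : P - 2 = 4 / ((d : ℝ) - 2) := by rw [hP]; field_simp; ring
  have hPpos : 0 < P - 2 := by rw [hP2]; positivity
  have hP0 : 0 < P := by linarith
  refine ⟨(16 * P / (P - 2) * (2 * M) ^ (P - 2)) ^ (1 / P), by positivity, ?_⟩
  intro p hp u hu hw
  subst hp
  have hcont : Continuous (𝓕 u) :=
    VectorFourier.fourierIntegral_continuous Real.continuous_fourierChar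
      (L := innerₗ (EuclideanSpace ℝ (Fin d))) continuous_inner hu
  set I := ∫ ξ, ‖ξ‖ ^ 2 * ‖𝓕 u ξ‖ ^ 2 with hI
  have hI0 : 0 ≤ I := integral_nonneg fun ξ => by positivity
  set J : ℤ → ℝ := fun k => ∫ ξ in {ξ : EuclideanSpace ℝ (Fin d) |
    (2 : ℝ) ^ k ≤ ‖ξ‖ ∧ ‖ξ‖ ≤ (2 : ℝ) ^ (k + 1)}, ‖ξ‖ ^ 2 * ‖𝓕 u ξ‖ ^ 2 with hJ
  have hJ0 : ∀ k, 0 ≤ J k := fun k => integral_nonneg fun ξ => by positivity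
  have hJI : ∀ k, J k ≤ I := fun k =>
    setIntegral_le_integral hw (Filter.Eventually.of_forall fun ξ => by
      simp only [Pi.zero_apply]; positivity)
  have hbdd : BddAbove (Set.range fun k => J k ^ ((1 : ℝ) / 2)) := by
    refine ⟨I ^ ((1 : ℝ) / 2), ?_⟩
    rintro _ ⟨k, rfl⟩
    exact Real.rpow_le_rpow (hJ0 k) (hJI k) (by norm_num)
  change _ ≤ _ * (⨆ k, J k ^ ((1 : ℝ) / 2)) ^ (1 - 2 / P)
  set B := ⨆ k, J k ^ ((1 : ℝ) / 2) with hB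
  have hB0 : 0 ≤ B := Real.iSup_nonneg fun k => Real.rpow_nonneg (hJ0 k) _
  have step : ∀ B' > B, ∫ x, ‖u x‖ ^ P ≤ (16 * P / (P - 2) * (2 * (M * B')) ^ (P - 2)) * I := by
    intro B' hB'
    have hB'0 : 0 < B' := hB0.trans_lt hB'
    apply strong u hu hw (s := ((d : ℝ) - 2) / 2) (by positivity) (by positivity) (by linarith)
    · rw [hP2]; field_simp; norm_num
    · apply hlow _ hcont B' hB'0
      intro k
      have h1 : J k ^ ((1 : ℝ) / 2) ≤ B' := (le_ciSup hbdd k).trans hB'.le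
      rw [← Real.sqrt_eq_rpow] at h1
      exact (Real.sqrt_le_left hB'0.le).1 h1
  have lim : ∫ x, ‖u x‖ ^ P ≤ (16 * P / (P - 2) * (2 * (M * B)) ^ (P - 2)) * I := by
    have hc : Continuous fun x : ℝ => (16 * P / (P - 2) * (2 * (M * x)) ^ (P - 2)) * I := by
      have : Continuous fun x : ℝ => (2 * (M * x)) ^ (P - 2) :=
        (by fun_prop : Continuous fun x : ℝ => 2 * (M * x)).rpow_const (fun _ => Or.inr hPpos.le)
      fun_prop
    have ht : Filter.Tendsto (fun x : ℝ => (16 * P / (P - 2) * (2 * (M * x)) ^ (P - 2)) * I)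
        (nhdsWithin B (Set.Ioi B)) (nhds ((16 * P / (P - 2) * (2 * (M * B)) ^ (P - 2)) * I)) :=
      (hc.tendsto B).mono_left nhdsWithin_le_nhds
    apply ge_of_tendsto ht
    filter_upwards [self_mem_nhdsWithin] with x hx
    exact step x hx
  calc (∫ x, ‖u x‖ ^ P) ^ (1 / P)
      ≤ ((16 * P / (P - 2) * (2 * (M * B)) ^ (P - 2)) * I) ^ (1 / P) :=
        Real.rpow_le_rpow (integral_nonneg fun x => by positivity) lim (by positivity)
    _ = ((16 * P / (P - 2) * (2 * M) ^ (P - 2)) * I * B ^ (P - 2)) ^ (1 / P) := by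
        rw [← mul_assoc 2 M B, Real.mul_rpow (by positivity) hB0]
        congr 1; ring
    _ = _ := by
        rw [Real.mul_rpow (by positivity) (by positivity), Real.mul_rpow (by positivity) hI0,
          ← Real.rpow_mul hB0, ← Real.rpow_mul hI0]
        congr 2
        · congr 1; field_simp
        · field_simp
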